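/- arXiv:2405.04331 — 10 statements merged into one kernel-verified Lean document; each statement's English description precedes it below -/
import Mathlib

section
/- The set of matrices X ∈ sl₂(ℝ) satisfying det X = 1 and trace(J·X) < 0 is exactly the adjoint orbit of J, i.e. it equals {g·J·g⁻¹ : g ∈ SL₂(ℝ)}. -/
open Matrix

/-- The infinitesimal generator of rotations, `J = [[0,-1],[1,0]]`. -/
noncomputable def Jmat : Matrix (Fin 2) (Fin 2) ℝ := !![0, -1; 1, 0]

theorem conj_Jmat_eq (g : Matrix.SpecialLinearGroup (Fin 2) ℝ) :
    (g : Matrix (Fin 2) (Fin 2) ℝ) * Jmat * (g : Matrix (Fin 2) (Fin 2) ℝ)⁻¹ =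
      !![g 0 0 * g 1 0 + g 0 1 * g 1 1, -(g 0 0 ^ 2 + g 0 1 ^ 2);
         g 1 0 ^ 2 + g 1 1 ^ 2, -(g 0 0 * g 1 0 + g 0 1 * g 1 1)] := by
  rw [Matrix.inv_def, g.det_coe, Ring.inverse_one, one_smul, Matrix.adjugate_fin_two]
  ext i j
  fin_cases i <;> fin_cases j <;> simp [Jmat, Matrix.mul_apply, Fin.sum_univ_two] <;> ring

theorem trace_Jmat_mul (X : Matrix (Fin 2) (Fin 2) ℝ) : (Jmat * X).trace = X 0 1 - X 1 0 := by
  rw [Matrix.trace_fin_two, Matrix.mul_apply, Matrix.mul_apply, Fin.sum_univ_two, Fin.sum_univ_two]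
  simp [Jmat]
  ring

/-- The entries of a traceless matrix `!![a, b; c, -a]` of determinant one satisfy `b * c < 0`,
so `b < c` forces `0 < c`. -/
theorem lower_left_pos {a b c : ℝ} (hdet : -a ^ 2 - b * c = 1) (htr : b - c < 0) : 0 < c := by
  by_contra! hc
  nlinarith [mul_nonneg_of_nonpos_of_nonpos (show b ≤ 0 by linarith) hc, sq_nonneg a]

/-- **Characterization of the adjoint orbit of `J`.**
The set of 2×2 real traceless matrices `X` with `det X = 1` and `trace (J·X) < 0` is exactly
the adjoint orbit `{g·J·g⁻¹ : g ∈ SL₂(ℝ)}` of `J`. -/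
theorem adjoint_orbit_of_J :
    {X : Matrix (Fin 2) (Fin 2) ℝ | X.trace = 0 ∧ X.det = 1 ∧ (Jmat * X).trace < 0} =
    {X : Matrix (Fin 2) (Fin 2) ℝ |
      ∃ g : Matrix.SpecialLinearGroup (Fin 2) ℝ,
        X = (g : Matrix (Fin 2) (Fin 2) ℝ) * Jmat * (g : Matrix (Fin 2) (Fin 2) ℝ)⁻¹} := by
  ext X
  constructor
  · rintro ⟨htr, hdet, hneg⟩
    have hd : X 1 1 = -X 0 0 := by
      rw [Matrix.trace_fin_two] at htr
      linarith
    have hdet' : -X 0 0 ^ 2 - X 0 1 * X 1 0 = 1 := by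
      rw [Matrix.det_fin_two, hd] at hdet
      linarith
    have hc : 0 < X 1 0 := by
      rw [trace_Jmat_mul] at hneg
      exact lower_left_pos hdet' hneg
    have hs : √(X 1 0) ≠ 0 := (Real.sqrt_pos.2 hc).ne'
    have hsq : √(X 1 0) ^ 2 = X 1 0 := Real.sq_sqrt hc.le
    have hg : (!![1 / √(X 1 0), X 0 0 / √(X 1 0); 0, √(X 1 0)]).det = 1 := by
      simp [Matrix.det_fin_two, hs]
    refine ⟨⟨_, hg⟩, Eq.trans ?_ (conj_Jmat_eq _).symm⟩
    ext i j
    fin_cases i <;> fin_cases j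
    · simp [hs]
    · simp [div_pow, hsq]
      field_simp
      linarith
    · simp [hsq]
    · simp [hs, hd]
  · rintro ⟨g, rfl⟩
    have hg : g 0 0 * g 1 1 - g 0 1 * g 1 0 = 1 := by
      rw [← Matrix.det_fin_two, g.det_coe]
    rw [Set.mem_ofPred_eq, conj_Jmat_eq]
    refine ⟨by simp [Matrix.trace_fin_two], ?_, ?_⟩
    · rw [Matrix.det_fin_two_of]
      linear_combination (g 0 0 * g 1 1 - g 0 1 * g 1 0 + 1) * hg
    · rw [trace_Jmat_mul]
      simp only [Matrix.of_apply, Matrix.cons_val_zero, Matrix.cons_val_one]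
      nlinarith [sq_nonneg (g 0 0 - g 1 1), sq_nonneg (g 0 1 + g 1 0)]
end

section
/- Let X ∈ sl₂(ℝ) with X ≠ 0. Then the image of ad_X equals the trace-form orthogonal complement of X: {[W,X] : W ∈ sl₂(ℝ)} = {Y ∈ sl₂(ℝ) : trace(X·Y) = 0}. (In particular this applies to every X with det X = 1, i.e. every point of the adjoint orbit of J.) -/
/-- The double commutator identity for traceless 2×2 matrices, the analogue of the vector triple
product expansion. -/
theorem commutator_commutator_of_trace_eq_zero {R : Type*} [CommRing R]
    {A B C : Matrix (Fin 2) (Fin 2) R}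
    (hA : A.trace = 0) (hB : B.trace = 0) (hC : C.trace = 0) :
    (A * B - B * A) * C - C * (A * B - B * A) =
      (2 * (B * C).trace) • A - (2 * (A * C).trace) • B := by
  rw [Matrix.trace_fin_two, add_eq_zero_iff_eq_neg'] at hA hB hC
  ext i j
  fin_cases i <;> fin_cases j <;>
    simp [Matrix.mul_apply, Matrix.trace_fin_two, Fin.sum_univ_two, hA, hB, hC] <;> ring


/-- **Image of `ad X` is the trace-form orthogonal complement of `X` in sl₂(ℝ).**
For a nonzero traceless 2×2 real matrix `X`,
`{[W,X] : W ∈ sl₂(ℝ)} = {Y ∈ sl₂(ℝ) : trace (X·Y) = 0}`,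
where `[W,X] = W*X - X*W`. -/
theorem ad_image_eq_orthogonal_complement (X : Matrix (Fin 2) (Fin 2) ℝ)
    (hXtr : X.trace = 0) (hX0 : X ≠ 0) :
    {Y : Matrix (Fin 2) (Fin 2) ℝ |
        ∃ W : Matrix (Fin 2) (Fin 2) ℝ, W.trace = 0 ∧ Y = W * X - X * W} =
    {Y : Matrix (Fin 2) (Fin 2) ℝ | Y.trace = 0 ∧ (X * Y).trace = 0} := by
  ext Y
  simp only [Set.mem_ofPred_eq]
  constructor
  · rintro ⟨W, -, rfl⟩
    refine ⟨by rw [Matrix.trace_sub, Matrix.trace_mul_comm, sub_self], ?_⟩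
    rw [mul_sub, Matrix.trace_sub, ← mul_assoc, Matrix.trace_mul_comm (X * W) X, sub_self]
  · rintro ⟨hY, hXY⟩
    have hs : (X.transpose * X).trace ≠ 0 := by
      rw [← Matrix.conjTranspose_eq_transpose_of_trivial]
      exact mt Matrix.trace_conjTranspose_mul_self_eq_zero_iff.mp hX0
    have key := commutator_commutator_of_trace_eq_zero hY
      ((Matrix.trace_transpose X).trans hXtr) hXtr
    rw [Matrix.trace_mul_comm Y X, hXY, mul_zero, zero_smul, sub_zero] at key
    refine ⟨(2 * (X.transpose * X).trace)⁻¹ • (Y * X.transpose - X.transpose * Y), ?_, ?_⟩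
    · rw [Matrix.trace_smul, Matrix.trace_sub, Matrix.trace_mul_comm Y, sub_self, smul_zero]
    · rw [smul_mul_assoc, mul_smul_comm, ← smul_sub, key,
        inv_smul_smul₀ (mul_ne_zero two_ne_zero hs)]
end

section
/- (i) For every X = [[a,b],[c,−a]] ∈ sl₂(ℝ) and every u = (u₀,u₁,u₂) ∈ ℝ³, ⟨Z_u, X⟩ = −(2/√3)·(ρ₂(X)·u₀ + ρ₁(X)·u₁ + ρ₀(X)·u₂). (ii) Consequently, the star inequalities ρ₀(X) > 0, ρ₁(X) > 0, ρ₂(X) > 0 hold if and only if ⟨Z_u, X⟩ < 0 for every u in the two-simplex U_T. -/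
noncomputable section

open Matrix

/-- The star function `ρ₀(X) = (c + √3·a)/√3` for `X = [[a,b],[c,−a]]`. -/
def rho0 (X : Matrix (Fin 2) (Fin 2) ℝ) : ℝ := (X 1 0 + Real.sqrt 3 * X 0 0) / Real.sqrt 3

/-- The star function `ρ₁(X) = (c − √3·a)/√3` for `X = [[a,b],[c,−a]]`. -/
def rho1 (X : Matrix (Fin 2) (Fin 2) ℝ) : ℝ := (X 1 0 - Real.sqrt 3 * X 0 0) / Real.sqrt 3

/-- The star function `ρ₂(X) = −(3b + c)/(2√3)` for `X = [[a,b],[c,−a]]`. -/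
def rho2 (X : Matrix (Fin 2) (Fin 2) ℝ) : ℝ := -(3 * X 0 1 + X 1 0) / (2 * Real.sqrt 3)

/-- The control matrix `Z_u` of a control `u = (u₀,u₁,u₂)`. -/
def Zmat (u₀ u₁ u₂ : ℝ) : Matrix (Fin 2) (Fin 2) ℝ :=
  !![(u₁ - u₂) / Real.sqrt 3, (u₀ - 2*u₁ - 2*u₂) / 3;
     u₀, (u₂ - u₁) / Real.sqrt 3]

/-- A general element `X = [[a,b],[c,−a]]` of sl₂(ℝ). -/
def Xmat (a b c : ℝ) : Matrix (Fin 2) (Fin 2) ℝ := !![a, b; c, -a]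

/-- The trace pairing of a control matrix with `X`, written in terms of the star functions. -/
theorem trace_Zmat_mul_Xmat (a b c u₀ u₁ u₂ : ℝ) :
    (Zmat u₀ u₁ u₂ * Xmat a b c).trace =
      -(2 / Real.sqrt 3) *
        (rho2 (Xmat a b c) * u₀ + rho1 (Xmat a b c) * u₁ + rho0 (Xmat a b c) * u₂) := by
  have h3 : Real.sqrt 3 ^ 2 = 3 := Real.sq_sqrt (by norm_num)
  simp only [Zmat, Xmat, rho0, rho1, rho2, Matrix.trace_fin_two, Matrix.mul_apply,
    Fin.sum_univ_two, Matrix.of_apply, Matrix.cons_val', Matrix.cons_val_zero,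
    Matrix.cons_val_one, Matrix.cons_val_fin_one]
  field_simp
  linear_combination ((u₀ - 2 * u₁ - 2 * u₂) * c + 3 * u₀ * b) * h3

/-- A linear form is positive on the standard two-simplex iff its coefficients are positive. -/
theorem forall_simplex_pos_iff (p q r : ℝ) :
    (∀ x y z : ℝ, 0 ≤ x → 0 ≤ y → 0 ≤ z → x + y + z = 1 → 0 < p * x + q * y + r * z) ↔
      0 < r ∧ 0 < q ∧ 0 < p := by
  constructor
  · intro h
    refine ⟨?_, ?_, ?_⟩
    · simpa using h 0 0 1
    · simpa using h 0 1 0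
    · simpa using h 1 0 0
  · rintro ⟨hr, hq, hp⟩ x y z hx hy hz hsum
    have hpx := mul_nonneg hp.le hx
    have hqy := mul_nonneg hq.le hy
    have hrz := mul_nonneg hr.le hz
    rcases hx.eq_or_lt with rfl | hx
    · rcases hy.eq_or_lt with rfl | hy
      · have hz : z = 1 := by linarith
        simpa [hz] using hr
      · linarith [mul_pos hq hy]
    · linarith [mul_pos hp hx]

/-- **Star inequalities via the control matrices.**
(i) For every `X = [[a,b],[c,−a]] ∈ sl₂(ℝ)` and every `u = (u₀,u₁,u₂) ∈ ℝ³`,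
`⟨Z_u, X⟩ = −(2/√3)·(ρ₂(X)·u₀ + ρ₁(X)·u₁ + ρ₀(X)·u₂)`, where `⟨A,B⟩ = trace (A·B)`.
(ii) The star inequalities `ρ₀(X) > 0`, `ρ₁(X) > 0`, `ρ₂(X) > 0` hold if and only if
`⟨Z_u, X⟩ < 0` for every `u` in the two-simplex `U_T`. -/
theorem trace_Zmat_eq_and_star_iff (a b c : ℝ) :
    (∀ u₀ u₁ u₂ : ℝ,
        (Zmat u₀ u₁ u₂ * Xmat a b c).trace =
          -(2 / Real.sqrt 3) *
            (rho2 (Xmat a b c) * u₀ + rho1 (Xmat a b c) * u₁ + rho0 (Xmat a b c) * u₂)) ∧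
    ((0 < rho0 (Xmat a b c) ∧ 0 < rho1 (Xmat a b c) ∧ 0 < rho2 (Xmat a b c)) ↔
      ∀ u₀ u₁ u₂ : ℝ, 0 ≤ u₀ → 0 ≤ u₁ → 0 ≤ u₂ → u₀ + u₁ + u₂ = 1 →
        (Zmat u₀ u₁ u₂ * Xmat a b c).trace < 0) := by
  have hs : 0 < 2 / Real.sqrt 3 := by positivity
  refine ⟨trace_Zmat_mul_Xmat a b c, ?_⟩
  simp only [trace_Zmat_mul_Xmat, neg_mul, neg_lt_zero, mul_pos_iff_of_pos_left hs]
  exact (forall_simplex_pos_iff _ _ _).symm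

end
end

section
/- Let z = x + iy with y > 0 and let X := Φ(z). Then the star inequalities ρ₀(X) > 0, ρ₁(X) > 0, ρ₂(X) > 0 hold if and only if −1/√3 < x < 1/√3 and x² + y² > 1/3; that is, the star domain in the upper half-plane is the open ideal triangle with vertices ±1/√3 and ∞. -/
noncomputable section

open Matrix

/-- The map `Φ(x + iy) = [[x/y, −(x²+y²)/y],[1/y, −x/y]]` from the upper half-plane to sl₂(ℝ). -/
def Phi (x y : ℝ) : Matrix (Fin 2) (Fin 2) ℝ := !![x/y, -(x^2 + y^2)/y; 1/y, -x/y]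

/-- **The star domain is an ideal triangle.**
For `z = x + iy` with `y > 0` and `X = Φ(z)`, the star inequalities `ρ₀(X) > 0`, `ρ₁(X) > 0`,
`ρ₂(X) > 0` hold if and only if `−1/√3 < x < 1/√3` and `x² + y² > 1/3`. -/
theorem star_domain_ideal_triangle (x y : ℝ) (hy : 0 < y) :
    (0 < rho0 (Phi x y) ∧ 0 < rho1 (Phi x y) ∧ 0 < rho2 (Phi x y)) ↔
    (-(1 / Real.sqrt 3) < x ∧ x < 1 / Real.sqrt 3 ∧ 1/3 < x^2 + y^2) := by
  have h3 : 0 < Real.sqrt 3 := by positivity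
  have e0 : rho0 (Phi x y) = (1 + Real.sqrt 3 * x) / (y * Real.sqrt 3) := by
    simp [rho0, Phi]
    field_simp
  have e1 : rho1 (Phi x y) = (1 - Real.sqrt 3 * x) / (y * Real.sqrt 3) := by
    simp [rho1, Phi]
    field_simp
  have e2 : rho2 (Phi x y) = (3 * (x ^ 2 + y ^ 2) - 1) / (2 * (y * Real.sqrt 3)) := by
    simp [rho2, Phi]
    field_simp
    ring
  rw [e0, e1, e2, div_pos_iff_of_pos_right (by positivity),
    div_pos_iff_of_pos_right (by positivity), div_pos_iff_of_pos_right (by positivity),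
    ← neg_div, div_lt_iff₀ h3, lt_div_iff₀ h3]
  constructor <;> rintro ⟨h, h', h''⟩ <;> refine ⟨?_, ?_, ?_⟩ <;> linarith

end
end

section
/- Let s be a multi-point and let σ be a multi-curve on [0,T] of class C^k (k ≥ 0, with C⁰ meaning continuous). Then there exists a unique map g : [0,T] → M₂(ℝ) such that σ_j(t) = g(t)·s_j for all j ∈ ℤ/6ℤ and all t ∈ [0,T]; moreover det g(t) = 1 for every t (so g takes values in SL₂(ℝ)) and g is of class C^k. -/
noncomputable section

/-- The determinant of the 2×2 matrix with columns `v` and `w`. -/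
def det2 (v w : Fin 2 → ℝ) : ℝ := v 0 * w 1 - v 1 * w 0

/-- A **multi-point**: a function `s : ℤ/6ℤ → ℝ²` with `s_j + s_{j+2} + s_{j+4} = 0`,
`s_{j+3} = −s_j` and `det(s_j, s_{j+1}) = √3/2` for all `j`. -/
def IsMultiPoint (s : ZMod 6 → Fin 2 → ℝ) : Prop :=
  ∀ j : ZMod 6,
    s j + s (j + 2) + s (j + 4) = 0 ∧
    s (j + 3) = -s j ∧
    det2 (s j) (s (j + 1)) = Real.sqrt 3 / 2

/-- The matrix whose columns are the values of `s` at `0` and `1`. -/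
def frameMatrix (s : ZMod 6 → Fin 2 → ℝ) : Matrix (Fin 2) (Fin 2) ℝ :=
  Matrix.of fun i j => s (if j = 0 then 0 else 1) i

theorem IsMultiPoint.det_frameMatrix {s : ZMod 6 → Fin 2 → ℝ} (hs : IsMultiPoint s) :
    (frameMatrix s).det = Real.sqrt 3 / 2 := by
  have h := (hs 0).2.2
  rw [zero_add] at h
  rw [← h, Matrix.det_fin_two, det2]
  simp [frameMatrix]
  ring

theorem IsMultiPoint.isUnit_det_frameMatrix {s : ZMod 6 → Fin 2 → ℝ} (hs : IsMultiPoint s) :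
    IsUnit (frameMatrix s).det := by
  rw [hs.det_frameMatrix, isUnit_iff_ne_zero]
  positivity

/-- A multi-point is an explicit linear combination of its values at `0` and `1`. -/
theorem IsMultiPoint.eq_frameMatrix_mulVec {s : ZMod 6 → Fin 2 → ℝ} (hs : IsMultiPoint s)
    (j : ZMod 6) :
    s j = (frameMatrix s).mulVec
      (![![1, 0], ![0, 1], ![-1, 1], ![-1, 0], ![0, -1], ![1, -1]] j) := by
  have h0 := (hs 0).1
  have h3 := (hs 0).2.1
  have h4 := (hs 1).2.1
  have h5 := (hs 2).2.1
  change s 0 + s 2 + s 4 = 0 at h0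
  change s 3 = -s 0 at h3
  change s 4 = -s 1 at h4
  change s 5 = -s 2 at h5
  ext i
  have e0 := congrFun h0 i
  have e3 := congrFun h3 i
  have e4 := congrFun h4 i
  have e5 := congrFun h5 i
  simp only [Pi.add_apply, Pi.neg_apply, Pi.zero_apply] at e0 e3 e4 e5
  rw [Matrix.mulVec, dotProduct, Fin.sum_univ_two]
  have f0 : frameMatrix s i 0 = s 0 i := rfl
  have f1 : frameMatrix s i 1 = s 1 i := rfl
  rw [f0, f1]
  change Fin 6 at j
  fin_cases j
  · change s 0 i = s 0 i * 1 + s 1 i * 0; linarith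
  · change s 1 i = s 0 i * 0 + s 1 i * 1; linarith
  · change s 2 i = s 0 i * (-1) + s 1 i * 1; linarith
  · change s 3 i = s 0 i * (-1) + s 1 i * 0; linarith
  · change s 4 i = s 0 i * 0 + s 1 i * (-1); linarith
  · change s 5 i = s 0 i * 1 + s 1 i * (-1); linarith

theorem mul_frameMatrix_eq {s s' : ZMod 6 → Fin 2 → ℝ} {A : Matrix (Fin 2) (Fin 2) ℝ}
    (h : ∀ j, A.mulVec (s j) = s' j) : A * frameMatrix s = frameMatrix s' := by
  ext i j
  exact congrFun (h (if j = 0 then 0 else 1)) i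

/-- **A multi-curve is driven by a curve in SL₂(ℝ).**
Given a multi-point `s` and a `C^k` multi-curve `σ` on `[0,T]`, there is a unique map
`g : [0,T] → M₂(ℝ)` with `σ_j(t) = g(t)·s_j` for all `j` and `t ∈ [0,T]`; moreover
`det (g t) = 1` for all `t ∈ [0,T]` and `g` is of class `C^k` (entrywise). -/
theorem multicurve_eq_matrix_curve_mul_multipoint (k : ℕ∞) (T : ℝ) (hT : 0 ≤ T)
    (s : ZMod 6 → Fin 2 → ℝ) (hs : IsMultiPoint s)
    (σ : ZMod 6 → ℝ → Fin 2 → ℝ)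
    (hσpt : ∀ t ∈ Set.Icc (0:ℝ) T, IsMultiPoint fun j => σ j t)
    (hσk : ∀ j : ZMod 6, ContDiffOn ℝ k (σ j) (Set.Icc (0:ℝ) T)) :
    ∃ g : ℝ → Matrix (Fin 2) (Fin 2) ℝ,
      (∀ t ∈ Set.Icc (0:ℝ) T, ∀ j : ZMod 6, (g t).mulVec (s j) = σ j t) ∧
      (∀ t ∈ Set.Icc (0:ℝ) T, (g t).det = 1) ∧
      (∀ i j : Fin 2, ContDiffOn ℝ k (fun t => g t i j) (Set.Icc (0:ℝ) T)) ∧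
      (∀ g' : ℝ → Matrix (Fin 2) (Fin 2) ℝ,
        (∀ t ∈ Set.Icc (0:ℝ) T, ∀ j : ZMod 6, (g' t).mulVec (s j) = σ j t) →
        Set.EqOn g g' (Set.Icc (0:ℝ) T)) := by
  have hu := hs.isUnit_det_frameMatrix
  refine ⟨fun t => frameMatrix (fun j => σ j t) * (frameMatrix s)⁻¹, fun t ht j => ?_,
    fun t ht => ?_, fun i j => ?_, fun g' hg' t ht => ?_⟩
  · rw [hs.eq_frameMatrix_mulVec j, Matrix.mulVec_mulVec,
      Matrix.nonsing_inv_mul_cancel_right _ _ hu]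
    exact ((hσpt t ht).eq_frameMatrix_mulVec j).symm
  · rw [Matrix.det_mul, (hσpt t ht).det_frameMatrix, ← hs.det_frameMatrix, ← Matrix.det_mul,
      Matrix.mul_nonsing_inv _ hu, Matrix.det_one]
  · simp only [Matrix.mul_apply]
    exact ContDiffOn.sum fun l _ =>
      (contDiffOn_pi.1 (hσk (if l = 0 then 0 else 1)) i).mul contDiffOn_const
  · change frameMatrix (fun j => σ j t) * (frameMatrix s)⁻¹ = g' t
    rw [← mul_frameMatrix_eq (hg' t ht), Matrix.mul_nonsing_inv_cancel_right _ _ hu]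

end
end

section
/- For x, y ∈ ℝ with y > 0, define ρ₀ := (1+√3·x)/(√3·y), ρ₁ := (1−√3·x)/(√3·y), ρ₂ := (3(x²+y²)−1)/(2√3·y), and area₀(x,y) := (√3/4)·(ρ₀·ρ₂ − 2·√(ρ₀·ρ₁²·ρ₂)). Then for every fixed y ≥ 1, the function x ↦ area₀(x,y) is strictly increasing on the interval (0, 1/√3). -/
noncomputable section

/-- `area₀(x,y) = (√3/4)·(ρ₀ρ₂ − 2√(ρ₀ρ₁²ρ₂))`, where `ρ₀ = (1+√3x)/(√3y)`,
`ρ₁ = (1−√3x)/(√3y)`, `ρ₂ = (3(x²+y²)−1)/(2√3y)` are the star functions of `Φ(x+iy)`. -/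
def area0 (x y : ℝ) : ℝ :=
  (Real.sqrt 3 / 4) *
    (((1 + Real.sqrt 3 * x) / (Real.sqrt 3 * y)) * ((3*(x^2 + y^2) - 1) / (2 * Real.sqrt 3 * y)) -
      2 * Real.sqrt (((1 + Real.sqrt 3 * x) / (Real.sqrt 3 * y)) *
        ((1 - Real.sqrt 3 * x) / (Real.sqrt 3 * y))^2 *
        ((3*(x^2 + y^2) - 1) / (2 * Real.sqrt 3 * y))))

/-- The numerator of `ρ₀ρ₂` is strictly increasing in `t = √3 x`. -/
lemma one_add_mul_sq_add_lt {c s t : ℝ} (hc : 0 < c) (hs : 0 ≤ s) (hst : s < t) :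
    (1 + s) * (s ^ 2 + c) < (1 + t) * (t ^ 2 + c) := by
  have h : s ^ 2 < t ^ 2 := by gcongr
  gcongr

/-- The numerator of `ρ₀ρ₁²ρ₂` is decreasing in `t = √3 x`. -/
lemma one_add_mul_one_sub_sq_mul_sq_add_le {c s t : ℝ} (hc : 1 ≤ c) (hs : 0 ≤ s)
    (hst : s ≤ t) (ht : t ≤ 1) :
    (1 + t) * (1 - t) ^ 2 * (t ^ 2 + c) ≤ (1 + s) * (1 - s) ^ 2 * (s ^ 2 + c) := by
  have h : s ^ 2 ≤ t ^ 2 := by gcongr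
  have ht2 : t ^ 2 ≤ 1 := pow_le_one₀ (hs.trans hst) ht
  have hle : (1 - t ^ 2) * (t ^ 2 + c) ≤ (1 - s ^ 2) * (s ^ 2 + c) := by
    nlinarith [mul_nonneg (sub_nonneg.2 h) (add_nonneg (sub_nonneg.2 hc)
      (add_nonneg (sq_nonneg s) (sq_nonneg t)))]
  have hnn : 0 ≤ (1 - t ^ 2) * (t ^ 2 + c) :=
    mul_nonneg (sub_nonneg.2 ht2) (by positivity)
  calc (1 + t) * (1 - t) ^ 2 * (t ^ 2 + c) = (1 - t) * ((1 - t ^ 2) * (t ^ 2 + c)) := by ring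
    _ ≤ (1 - s) * ((1 - s ^ 2) * (s ^ 2 + c)) :=
      mul_le_mul (by linarith) hle hnn (by linarith)
    _ = (1 + s) * (1 - s) ^ 2 * (s ^ 2 + c) := by ring

/-- **Monotonicity of `area₀`.**
For every fixed `y ≥ 1`, the function `x ↦ area₀(x,y)` is strictly increasing on
the interval `(0, 1/√3)`. -/
theorem area0_strictMonoOn (y : ℝ) (hy : 1 ≤ y) :
    StrictMonoOn (fun x => area0 x y) (Set.Ioo 0 (1 / Real.sqrt 3)) := by
  intro a ha b hb hab
  have h3 : 0 < Real.sqrt 3 := by positivity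
  have hsq : Real.sqrt 3 ^ 2 = 3 := Real.sq_sqrt (by norm_num)
  have hy0 : 0 < y := by linarith
  have hc : 1 ≤ 3 * y ^ 2 - 1 := by nlinarith
  have hs : 0 ≤ Real.sqrt 3 * a := (mul_pos h3 ha.1).le
  have hst : Real.sqrt 3 * a < Real.sqrt 3 * b := by gcongr
  have ht : Real.sqrt 3 * b ≤ 1 := by
    rw [mul_comm]
    exact ((lt_div_iff₀ h3).1 hb.2).le
  have hprod (x : ℝ) :
      ((1 + Real.sqrt 3 * x) / (Real.sqrt 3 * y)) *
          ((3 * (x ^ 2 + y ^ 2) - 1) / (2 * Real.sqrt 3 * y)) =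
        (1 + Real.sqrt 3 * x) * ((Real.sqrt 3 * x) ^ 2 + (3 * y ^ 2 - 1)) /
          (2 * (Real.sqrt 3 * y) ^ 2) := by
    rw [mul_pow _ x, hsq]
    field_simp
    ring
  have hroot (x : ℝ) :
      ((1 + Real.sqrt 3 * x) / (Real.sqrt 3 * y)) *
          ((1 - Real.sqrt 3 * x) / (Real.sqrt 3 * y)) ^ 2 *
          ((3 * (x ^ 2 + y ^ 2) - 1) / (2 * Real.sqrt 3 * y)) =
        (1 + Real.sqrt 3 * x) * (1 - Real.sqrt 3 * x) ^ 2 *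
          ((Real.sqrt 3 * x) ^ 2 + (3 * y ^ 2 - 1)) / (2 * (Real.sqrt 3 * y) ^ 4) := by
    rw [mul_right_comm, hprod]
    field_simp
  simp only [area0, hprod, hroot, sub_eq_add_neg (_ / _)]
  refine mul_lt_mul_of_pos_left (add_lt_add_of_lt_of_le ?_ (neg_le_neg ?_)) (by positivity)
  · exact div_lt_div_of_pos_right (one_add_mul_sq_add_lt (by linarith) hs hst) (by positivity)
  · refine mul_le_mul_of_nonneg_left (Real.sqrt_le_sqrt ?_) zero_le_two
    exact div_le_div_of_nonneg_right
      (one_add_mul_one_sub_sq_mul_sq_add_le hc hs hst.le ht) (by positivity)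

end
end

section
/- Define f(y,r) := 2r(y−1)y·ln(r) − (r−y)·( r(y−1) + y(2y−5) + y²·ln(4/y) ) − 2r(y−1)y·ln(y). Then f(y,r) ≥ 0 for all (y,r) in the triangle T := {(y,r) ∈ ℝ² : 2 ≤ y ≤ 4, 2 ≤ r ≤ 4, y ≤ r}, and f(y,y) = 0 for all y ∈ [2,4]. -/
noncomputable section

/-- The switching-function estimate
`f(y,r) = 2r(y−1)y·ln r − (r−y)·(r(y−1) + y(2y−5) + y²·ln(4/y)) − 2r(y−1)y·ln y`. -/
def f12 (y r : ℝ) : ℝ :=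
  2*r*(y - 1)*y*Real.log r - (r - y)*(r*(y - 1) + y*(2*y - 5) + y^2*Real.log (4/y))
    - 2*r*(y - 1)*y*Real.log y

theorem log_le_half_sub_inv {t : ℝ} (ht : 1 ≤ t) : Real.log t ≤ (t - t⁻¹) / 2 := by
  rw [← Real.sinh_log (by linarith)]
  exact Real.self_le_sinh_iff.2 (Real.log_nonneg ht)

theorem two_mul_sub_div_add_le_log_sub_log {y r : ℝ} (hy : 0 < y) (hyr : y ≤ r) :
    2 * (r - y) / (r + y) ≤ Real.log r - Real.log y := by
  have hr : 0 < r := hy.trans_le hyr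
  have h := Real.le_log_one_add_of_nonneg (x := (r - y) / y)
    (div_nonneg (sub_nonneg.2 hyr) hy.le)
  have harg : 1 + (r - y) / y = r / y := by
    field_simp
    ring
  have hden : (r - y) / y + 2 = (r + y) / y := by
    field_simp
    ring
  rwa [harg, hden, ← mul_div_assoc, div_div_div_cancel_right₀ hy.ne',
    Real.log_div hr.ne' hy.ne'] at h

/-- The polynomial inequality left after replacing the logarithms in `f12` by rational bounds.
It is concave in `r`, hence follows from the endpoints `r = y` and `r = 4`. -/
theorem f12_polynomial_bound {y r : ℝ} (hy : 1 ≤ y) (hyr : y ≤ r) (hr : r ≤ 4) :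
    (r + y) * (r * (y - 1) + y * (2 * y - 5) + (2 * y - y ^ 3 / 8)) ≤ 4 * r * (y - 1) * y := by
  rcases (hyr.trans hr).eq_or_lt with rfl | hy4
  · obtain rfl : r = 4 := le_antisymm hr hyr
    norm_num
  have hpos : 0 < 4 - y := sub_pos.2 hy4
  refine sub_nonneg.1 ((mul_nonneg_iff_of_pos_left hpos).1 ?_)
  have hleft : 0 ≤ (4 - r) * (y ^ 2 * (y - 4) ^ 2 / 4) :=
    mul_nonneg (sub_nonneg.2 hr) (by positivity)
  have hright : 0 ≤ (r - y) * ((y - 4) ^ 2 * ((y - 2) ^ 2 + 4) / 8) :=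
    mul_nonneg (sub_nonneg.2 hyr) (by positivity)
  have hconc : 0 ≤ (y - 1) * ((r - y) * (4 - r) * (4 - y)) :=
    mul_nonneg (sub_nonneg.2 hy) (mul_nonneg (mul_nonneg (sub_nonneg.2 hyr) (sub_nonneg.2 hr))
      hpos.le)
  linear_combination hleft + hright + hconc

/-- **The key switching-function inequality for smoothed (6k+2)-gons.**
`f(y,r) ≥ 0` on the triangle `T = {(y,r) : 2 ≤ y ≤ 4, 2 ≤ r ≤ 4, y ≤ r}`, and `f(y,y) = 0`
for all `y ∈ [2,4]`. -/
theorem f12_nonneg_on_triangle :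
    (∀ y r : ℝ, 2 ≤ y → y ≤ 4 → 2 ≤ r → r ≤ 4 → y ≤ r → 0 ≤ f12 y r) ∧
    (∀ y : ℝ, 2 ≤ y → y ≤ 4 → f12 y y = 0) := by
  refine ⟨fun y r hy hy4 _ hr hyr => ?_, fun y _ _ => by unfold f12; ring⟩
  have hy0 : 0 < y := by linarith
  have hlog : y ^ 2 * Real.log (4 / y) ≤ 2 * y - y ^ 3 / 8 := by
    calc y ^ 2 * Real.log (4 / y)
        ≤ y ^ 2 * ((4 / y - (4 / y)⁻¹) / 2) := by
          gcongr
          exact log_le_half_sub_inv ((one_le_div hy0).2 hy4)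
      _ = 2 * y - y ^ 3 / 8 := by
          field_simp
          ring
  have hcoef : 0 ≤ 2 * r * (y - 1) * y :=
    mul_nonneg (mul_nonneg (by linarith) (by linarith)) hy0.le
  have hmain := mul_le_mul_of_nonneg_left (two_mul_sub_div_add_le_log_sub_log hy0 hyr) hcoef
  have hpoly : r * (y - 1) + y * (2 * y - 5) + (2 * y - y ^ 3 / 8)
      ≤ 4 * r * (y - 1) * y / (r + y) := by
    rw [le_div_iff₀' (by linarith)]
    exact f12_polynomial_bound (by linarith) hyr hr
  have hbracket := mul_le_mul_of_nonneg_left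
    ((add_le_add_right hlog (r * (y - 1) + y * (2 * y - 5))).trans hpoly) (sub_nonneg.2 hyr)
  have heq : (r - y) * (4 * r * (y - 1) * y / (r + y))
      = 2 * r * (y - 1) * y * (2 * (r - y) / (r + y)) := by
    ring
  unfold f12
  linarith

end
end

section
/- Let ζ := exp(2πi/3), let u ∈ {1, ζ, ζ²}, and let z⁰ = (z₁⁰, z₂⁰, z₃⁰) ∈ ℂ³ with z⁰ ≠ (0,0,0) and z₃⁰ ∈ W. Let z(t) = (z₁(t), z₂(t), z₃(t)) be the solution of the triangular Fuller system with constant control u and initial condition z⁰, i.e. z₁(t) = −i·t·u + z₁⁰, z₂(t) = −i·t²·u/2 + z₁⁰·t + z₂⁰, z₃(t) = −i·t³·u/6 + z₁⁰·t²/2 + z₂⁰·t + z₃⁰. Then z(t) ≠ (0,0,0) for all t ≥ 0. -/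
noncomputable section

/-- The primitive cube root of unity `ζ = exp(2πi/3)`. -/
def zeta : ℂ := Complex.exp (2 * Real.pi * Complex.I / 3)

/-- The wall set `W = ℝ_{≤0} ∪ ζ·ℝ_{≤0} ∪ ζ²·ℝ_{≤0} ⊂ ℂ`. -/
def Wall : Set ℂ := {w | ∃ s : ℝ, s ≤ 0 ∧ (w = (s : ℂ) ∨ w = zeta * s ∨ w = zeta^2 * s)}

theorem zeta_pow_three : zeta ^ 3 = 1 := by
  rw [zeta, ← Complex.exp_nat_mul, ← Complex.exp_two_pi_mul_I]
  congr 1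
  push_cast
  ring

theorem exists_real_cube_of_mem_Wall {w : ℂ} (hw : w ∈ Wall) : ∃ s : ℝ, w ^ 3 = (s : ℂ) := by
  obtain ⟨s, -, rfl | rfl | rfl⟩ := hw <;> refine ⟨s ^ 3, ?_⟩ <;> push_cast
  · rfl
  · rw [mul_pow, zeta_pow_three, one_mul]
  · rw [mul_pow, pow_right_comm, zeta_pow_three, one_pow, one_mul]

/-- **Constant-control Fuller trajectories starting on a wall never reach the origin.**
Let `u ∈ {1, ζ, ζ²}` and let `z⁰ = (z₁⁰,z₂⁰,z₃⁰) ≠ 0` with `z₃⁰ ∈ W`.  The solution of the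
triangular Fuller system with constant control `u` and initial condition `z⁰` is nonzero for
all `t ≥ 0`. -/
theorem fuller_trajectory_ne_zero (u : ℂ) (hu : u = 1 ∨ u = zeta ∨ u = zeta^2)
    (z1 z2 z3 : ℂ) (hz : ¬(z1 = 0 ∧ z2 = 0 ∧ z3 = 0)) (hz3 : z3 ∈ Wall)
    (t : ℝ) (ht : 0 ≤ t) :
    ¬(-Complex.I * t * u + z1 = 0 ∧
      -Complex.I * t^2 * u / 2 + z1 * t + z2 = 0 ∧
      -Complex.I * t^3 * u / 6 + z1 * t^2 / 2 + z2 * t + z3 = 0) := by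
  rintro ⟨h1, h2, h3⟩
  have hu3 : u ^ 3 = 1 := by
    rcases hu with rfl | rfl | rfl
    · exact one_pow 3
    · exact zeta_pow_three
    · rw [pow_right_comm, zeta_pow_three, one_pow]
  have hz3' : z3 = Complex.I * t ^ 3 * u / 6 := by
    linear_combination h3 - t * h2 + t ^ 2 / 2 * h1
  obtain ⟨s, hs⟩ := exists_real_cube_of_mem_Wall hz3
  have key : ((-(t ^ 9 / 216) : ℝ) : ℂ) * Complex.I = (s : ℂ) := by
    rw [← hs, hz3']
    push_cast
    linear_combination (-(Complex.I ^ 3 * t ^ 9 / 216)) * hu3 -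
      (t ^ 9 / 216 * Complex.I) * Complex.I_sq
  have ht0 : t = 0 := by
    have him := congrArg Complex.im key
    rw [Complex.im_ofReal_mul, Complex.I_im, Complex.ofReal_im] at him
    simpa using him
  subst ht0
  exact hz ⟨by simpa using h1, by simpa using h2, by simpa using h3⟩

end
end

section
/- Let U be a nonempty compact convex subset of the affine plane {(u₀,u₁,u₂) ∈ ℝ³ : u₀+u₁+u₂ = 1}, and let A, B : ℝ³ → ℝ be affine functions with B(u) ≠ 0 for all u ∈ U. Then the set M := {u ∈ U : A(u)/B(u) = sup_{v ∈ U} A(v)/B(v)} of maximizers of A/B on U is a nonempty face of U; that is, M is a nonempty convex subset of U such that for all x, y ∈ U and t ∈ (0,1), if t·x + (1−t)·y ∈ M then x ∈ M and y ∈ M. -/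
noncomputable section

/-- The set of maximizers of the ratio `A/B` over `U`:
`{u ∈ U : A(u)/B(u) = sup_{v ∈ U} A(v)/B(v)}`. -/
def ratioMaxSet (U : Set (Fin 3 → ℝ)) (A B : (Fin 3 → ℝ) →ᵃ[ℝ] ℝ) : Set (Fin 3 → ℝ) :=
  {u ∈ U | A u / B u = sSup ((fun v => A v / B v) '' U)}

theorem Convex.mul_pos_of_affine_ne_zero {E : Type*} [AddCommGroup E] [Module ℝ E] {U : Set E}
    (hU : Convex ℝ U) {B : E →ᵃ[ℝ] ℝ} (hB : ∀ u ∈ U, B u ≠ 0) {x y : E} (hx : x ∈ U)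
    (hy : y ∈ U) : 0 < B x * B y := by
  by_contra! h
  have h0 : (0 : ℝ) ∈ Set.uIcc (B x) (B y) := by
    rw [Set.mem_uIcc]
    rcases mul_nonpos_iff.mp h with h | h
    · exact Or.inr ⟨h.2, h.1⟩
    · exact Or.inl h
  obtain ⟨u, hu, hu0⟩ := (hU.affine_image B).ordConnected.uIcc_subset
    (Set.mem_image_of_mem B hx) (Set.mem_image_of_mem B hy) h0
  exact hB u hu hu0

/-- The maximizers of `A / B` are the zeros in `U` of an affine function that is nonpositive
on `U`. -/
theorem exists_affine_ratioMaxSet_eq {U : Set (Fin 3 → ℝ)} (hcomp : IsCompact U)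
    (hconv : Convex ℝ U) (hne : U.Nonempty) (A : (Fin 3 → ℝ) →ᵃ[ℝ] ℝ)
    {B : (Fin 3 → ℝ) →ᵃ[ℝ] ℝ} (hB : ∀ u ∈ U, B u ≠ 0) :
    ∃ g : (Fin 3 → ℝ) →ᵃ[ℝ] ℝ, (∀ u ∈ U, g u ≤ 0) ∧ ratioMaxSet U A B = {u ∈ U | g u = 0} := by
  obtain ⟨w, hw⟩ := hne
  set m := sSup ((fun v => A v / B v) '' U) with hm
  have hcont : ContinuousOn (fun v => A v / B v) U :=
    A.continuous_of_finiteDimensional.continuousOn.div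
      B.continuous_of_finiteDimensional.continuousOn hB
  have hle : ∀ u ∈ U, A u / B u ≤ m := fun u hu =>
    le_csSup (hcomp.bddAbove_image hcont) ⟨u, hu, rfl⟩
  have hg : ∀ u ∈ U, B w * (A u - m * B u) = (B w * B u) * (A u / B u - m) := fun u hu => by
    have := hB u hu
    field_simp
  refine ⟨B w • (A - m • B), fun u hu => ?_, ?_⟩
  · have := mul_nonpos_of_nonneg_of_nonpos (hconv.mul_pos_of_affine_ne_zero hB hw hu).le
      (sub_nonpos.mpr (hle u hu))
    simpa [hg u hu] using this
  · ext u
    refine and_congr_right fun hu => ?_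
    change A u / B u = m ↔ B w * (A u - m * B u) = 0
    rw [hg u hu, mul_eq_zero_iff_left (hconv.mul_pos_of_affine_ne_zero hB hw hu).ne', sub_eq_zero]

/-- **Maximizers of a ratio of affine functions form a face.**
Let `U` be a nonempty compact convex subset of the plane `{u₀+u₁+u₂ = 1} ⊂ ℝ³`, and let
`A`, `B` be affine functions with `B` nonvanishing on `U`.  Then the set `M` of maximizers
of `A/B` on `U` is a nonempty face of `U`: it is a nonempty convex subset of `U` such that
whenever a proper convex combination of `x, y ∈ U` lies in `M`, both `x` and `y` lie in `M`. -/
theorem ratio_maximizers_form_face (U : Set (Fin 3 → ℝ))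
    (hne : U.Nonempty) (hcomp : IsCompact U) (hconv : Convex ℝ U)
    (hplane : ∀ u ∈ U, u 0 + u 1 + u 2 = 1)
    (A B : (Fin 3 → ℝ) →ᵃ[ℝ] ℝ) (hB : ∀ u ∈ U, B u ≠ 0) :
    (ratioMaxSet U A B).Nonempty ∧
    Convex ℝ (ratioMaxSet U A B) ∧
    ratioMaxSet U A B ⊆ U ∧
    (∀ x ∈ U, ∀ y ∈ U, ∀ t ∈ Set.Ioo (0:ℝ) 1,
      t • x + (1 - t) • y ∈ ratioMaxSet U A B →
        x ∈ ratioMaxSet U A B ∧ y ∈ ratioMaxSet U A B) := by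
  have hcont : ContinuousOn (fun v => A v / B v) U :=
    A.continuous_of_finiteDimensional.continuousOn.div
      B.continuous_of_finiteDimensional.continuousOn hB
  refine ⟨?_, ?_⟩
  · obtain ⟨u, hu, h⟩ := hcomp.exists_sSup_image_eq hne hcont
    exact ⟨u, hu, h.symm⟩
  obtain ⟨g, hg, hM⟩ := exists_affine_ratioMaxSet_eq hcomp hconv hne A hB
  rw [hM]
  refine ⟨?_, Set.sep_subset _ _, ?_⟩
  · rintro x ⟨hx, hgx⟩ y ⟨hy, hgy⟩ a b ha hb hab
    refine ⟨hconv hx hy ha hb hab, ?_⟩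
    rw [Convex.combo_affine_apply hab, hgx, hgy, smul_zero, smul_zero, add_zero]
  · rintro x hx y hy t ⟨ht0, ht1⟩ ⟨-, h⟩
    rw [Convex.combo_affine_apply (add_sub_cancel t 1), smul_eq_mul, smul_eq_mul] at h
    have h1t : 0 < 1 - t := sub_pos.mpr ht1
    have hx' := mul_nonpos_of_nonneg_of_nonpos ht0.le (hg x hx)
    have hy' := mul_nonpos_of_nonneg_of_nonpos h1t.le (hg y hy)
    have hx0 : t * g x = 0 := by linarith
    have hy0 : (1 - t) * g y = 0 := by linarith
    exact ⟨⟨hx, (mul_eq_zero_iff_left ht0.ne').mp hx0⟩,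
      ⟨hy, (mul_eq_zero_iff_left h1t.ne').mp hy0⟩⟩

end
end

section
/- Let Ω := {(x₂,x₃) ∈ ℝ² : 0 < x₂, 0 < x₃, x₃ ≤ x₂, x₂²/2 ≤ x₃}. For (x₂,x₃) ∈ Ω and signs ε₂, ε₃ ∈ {−1, 1}, define sin₂ := x₃/x₂, cos₂ := √(1 − (x₃/x₂)²), cos₃ := x₂²/(2x₃), sin₃ := √(1 − x₂⁴/(4x₃²)), and v₂ := ε₂·cos₂ − 2·x₂·ε₃·sin₃, v₃ := x₂·(ε₂·cos₂·cos₃ + ε₃·sin₂·sin₃) − 3·x₃·ε₃·sin₃. Then (v₂, v₃) = (0, 0) if and only if either (x₂,x₃) = (2,2) (for any choice of signs), or (x₂,x₃) = (2/√10, √2/5) and ε₂ = ε₃. -/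
/-- **Equilibrium points of the Fuller vector field on the base space `Ω`.**
For `(x₂,x₃)` in `Ω = {0 < x₂, 0 < x₃, x₃ ≤ x₂, x₂²/2 ≤ x₃}` and signs `ε₂, ε₃ ∈ {−1,1}`,
with `sin₂ = x₃/x₂`, `cos₂ = √(1−(x₃/x₂)²)`, `cos₃ = x₂²/(2x₃)`, `sin₃ = √(1−x₂⁴/(4x₃²))`,
the vector field
`v₂ = ε₂·cos₂ − 2x₂·ε₃·sin₃`, `v₃ = x₂(ε₂·cos₂·cos₃ + ε₃·sin₂·sin₃) − 3x₃·ε₃·sin₃`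
vanishes exactly at `(x₂,x₃) = (2,2)` (any signs) and at `(x₂,x₃) = (2/√10, √2/5)` with
`ε₂ = ε₃`. -/
theorem fuller_base_equilibria (x₂ x₃ : ℝ) (h₂ : 0 < x₂) (h₃ : 0 < x₃)
    (h32 : x₃ ≤ x₂) (h23 : x₂^2 / 2 ≤ x₃)
    (ε₂ ε₃ : ℝ) (hε₂ : ε₂ = 1 ∨ ε₂ = -1) (hε₃ : ε₃ = 1 ∨ ε₃ = -1) :
    (ε₂ * Real.sqrt (1 - (x₃/x₂)^2) - 2 * x₂ * ε₃ * Real.sqrt (1 - x₂^4/(4*x₃^2)) = 0 ∧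
     x₂ * (ε₂ * Real.sqrt (1 - (x₃/x₂)^2) * (x₂^2/(2*x₃)) +
           ε₃ * (x₃/x₂) * Real.sqrt (1 - x₂^4/(4*x₃^2)))
       - 3 * x₃ * ε₃ * Real.sqrt (1 - x₂^4/(4*x₃^2)) = 0) ↔
    ((x₂ = 2 ∧ x₃ = 2) ∨
     (x₂ = 2 / Real.sqrt 10 ∧ x₃ = Real.sqrt 2 / 5 ∧ ε₂ = ε₃)) := by
  have hA : 0 ≤ 1 - (x₃ / x₂) ^ 2 := by
    rw [sub_nonneg, div_pow, div_le_one (by positivity)]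
    gcongr
  have hB : 0 ≤ 1 - x₂ ^ 4 / (4 * x₃ ^ 2) := by
    rw [sub_nonneg, div_le_one (by positivity)]
    nlinarith [sq_nonneg x₂]
  have hc := Real.sqrt_nonneg (1 - (x₃ / x₂) ^ 2)
  have hs := Real.sqrt_nonneg (1 - x₂ ^ 4 / (4 * x₃ ^ 2))
  have hc2 := Real.sq_sqrt hA
  have hs2 := Real.sq_sqrt hB
  set c := Real.sqrt (1 - (x₃ / x₂) ^ 2)
  set s := Real.sqrt (1 - x₂ ^ 4 / (4 * x₃ ^ 2))
  have hc2' : c ^ 2 * x₂ ^ 2 = x₂ ^ 2 - x₃ ^ 2 := by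
    rw [hc2]; field_simp
  have hs2' : s ^ 2 * (4 * x₃ ^ 2) = 4 * x₃ ^ 2 - x₂ ^ 4 := by
    rw [hs2]; field_simp
  have hv₃ : x₂ * (ε₂ * c * (x₂ ^ 2 / (2 * x₃)) + ε₃ * (x₃ / x₂) * s) - 3 * x₃ * ε₃ * s =
      (ε₂ * c * x₂ ^ 3 - 4 * x₃ ^ 2 * ε₃ * s) / (2 * x₃) := by
    field_simp; ring
  have hε₂sq : ε₂ ^ 2 = 1 := by rcases hε₂ with rfl | rfl <;> norm_num
  have hε₃sq : ε₃ ^ 2 = 1 := by rcases hε₃ with rfl | rfl <;> norm_num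
  have hε₃0 : ε₃ ≠ 0 := by rintro rfl; norm_num at hε₃sq
  have hε₂0 : ε₂ ≠ 0 := by rintro rfl; norm_num at hε₂sq
  rw [hv₃, div_eq_zero_iff, or_iff_left (by positivity : 2 * x₃ ≠ 0)]
  constructor
  · rintro ⟨h1, h2⟩
    have hprod : (ε₃ * s) * (x₂ ^ 4 - 2 * x₃ ^ 2) = 0 := by
      linear_combination (h2 - x₂ ^ 3 * h1) / 2
    rcases eq_or_ne s 0 with hs0 | hs0
    · left
      have hc0 : c = 0 := by simpa [hs0, hε₂0] using h1
      rw [hc0] at hc2'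
      rw [hs0] at hs2'
      have hx : x₃ = x₂ := by nlinarith
      subst hx
      have hx2 : x₃ = 2 := by
        have : x₃ ^ 2 * ((x₃ + 2) * (x₃ - 2)) = 0 := by linear_combination hs2'
        simp only [mul_eq_zero, pow_eq_zero_iff, h₂.ne', ne_eq, OfNat.ofNat_ne_zero,
          not_false_eq_true, (by positivity : x₃ + 2 ≠ 0), false_or] at this
        linarith
      exact ⟨hx2, hx2⟩
    · right
      have h4 : x₂ ^ 4 = 2 * x₃ ^ 2 := by
        have := (mul_eq_zero.mp hprod).resolve_left (mul_ne_zero hε₃0 hs0)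
        linarith
      have hs3 : s ^ 2 = 1 / 2 := by
        have : x₃ ^ 2 * (s ^ 2 - 1 / 2) = 0 := by linear_combination (hs2' - h4) / 4
        have := (mul_eq_zero.mp this).resolve_left (by positivity)
        linarith
      have hc3 : c ^ 2 = 2 * x₂ ^ 2 := by
        linear_combination (ε₂ * c + 2 * x₂ * ε₃ * s) * h1 - c ^ 2 * hε₂sq
          + 4 * x₂ ^ 2 * s ^ 2 * hε₃sq + 4 * x₂ ^ 2 * hs3
      have hx₂sq : x₂ ^ 2 = 2 / 5 := by
        have : x₂ ^ 2 * (x₂ ^ 2 - 2 / 5) = 0 := by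
          linear_combination (2 / 5) * hc2' - (2 / 5) * x₂ ^ 2 * hc3 + h4 / 5
        have := (mul_eq_zero.mp this).resolve_left (by positivity)
        linarith
      have hx₃sq : x₃ ^ 2 = 2 / 25 := by
        linear_combination -h4 / 2 + (x₂ ^ 2 + 2 / 5) / 2 * hx₂sq
      refine ⟨?_, ?_, ?_⟩
      · rw [← sq_eq_sq₀ h₂.le (by positivity), div_pow, Real.sq_sqrt (by norm_num), hx₂sq]
        norm_num
      · rw [← sq_eq_sq₀ h₃.le (by positivity), div_pow, Real.sq_sqrt (by norm_num), hx₃sq]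
        norm_num
      · have hpos : 0 < x₂ * s := by positivity
        rcases hε₂ with rfl | rfl <;> rcases hε₃ with rfl | rfl <;> first | rfl | nlinarith
  · rintro (⟨rfl, rfl⟩ | ⟨hx₂, hx₃, rfl⟩)
    · have hc0 : c = 0 := by nlinarith
      have hs0 : s = 0 := by nlinarith
      simp [hc0, hs0]
    · have hx₂sq : x₂ ^ 2 = 2 / 5 := by
        rw [hx₂, div_pow, Real.sq_sqrt (by norm_num)]; norm_num
      have hx₃sq : x₃ ^ 2 = 2 / 25 := by
        rw [hx₃, div_pow, Real.sq_sqrt (by norm_num)]; norm_num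
      have hx₂4 : x₂ ^ 4 = 4 / 25 := by
        linear_combination (x₂ ^ 2 + 2 / 5) * hx₂sq
      rw [hx₂sq, hx₃sq] at hc2'
      rw [hx₂4, hx₃sq] at hs2'
      have hcs : c = 2 * x₂ * s := by
        rw [← sq_eq_sq₀ hc (by positivity)]
        linear_combination (5 / 2) * hc2' - 4 * s ^ 2 * hx₂sq - 5 * hs2'
      constructor
      · rw [hcs]; ring
      · rw [hcs, hx₃sq]
        linear_combination 2 * ε₂ * s * hx₂4
end
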